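/- Assume L_{u₀} > 0 and that there exist constants K₁, K₂ > 0 such that for every δ > 0 there is a bounded function u_{0,δ} : ℝ^d → ℝ with ‖u₀ − u_{0,δ}‖_{L^∞(ℝ^d)} ≤ L_{u₀}δ^a, |u_{0,δ}(x+y) − u_{0,δ}(x)| ≤ K₁ L_{u₀} δ^{a−1}|y| and |u_{0,δ}(x+y) + u_{0,δ}(x−y) − 2u_{0,δ}(x)| ≤ K₂ L_{u₀} δ^{a−2}|y|² for all x, y ∈ ℝ^d. Assume the CFL condition holds for u₀ and for each u_{0,δ} (with their common Hölder data constants). Then for all j, k ≥ 0 with j + k ≤ N, the extended scheme satisfies sup_{x∈ℝ^d} |U^{j+k}(x) − U^j(x)| ≤ K̃ t_k^{a/(2+(1−a)(p−2))} + ‖f‖_{L^∞(ℝ^d)} t_k, where t_k = kτ and K̃ = 4^{(2+(1−a)(p−2)−a)/(2+(1−a)(p−2))} · L_{u₀}^{p/(2+(1−a)(p−2))} · ((p−1) K₁^{p−2} K₂ M)^{a/(2+(1−a)(p−2))}. -/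

import Mathlib

open scoped BigOperators

/-- `J_p(ξ) = |ξ|^{p-2} ξ`. -/
noncomputable def Jp (p ξ : ℝ) : ℝ := |ξ| ^ (p - 2) * ξ

/-- The grid point `y_β = h β ∈ ℝ^d` for `β ∈ ℤ^d`. -/
noncomputable def ygrid (d : ℕ) (h : ℝ) (β : Fin d → ℤ) : EuclideanSpace ℝ (Fin d) :=
  (WithLp.equiv 2 (Fin d → ℝ)).symm (fun i => h * (β i : ℝ))

/-- The discrete `p`-Laplacian `D_p^h ψ(x) = Σ_β J_p(ψ(x+y_β) - ψ(x)) ω_β`. -/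
noncomputable def Dph (d : ℕ) (p h : ℝ) (ω : (Fin d → ℤ) → ℝ)
    (ψ : EuclideanSpace ℝ (Fin d) → ℝ) (x : EuclideanSpace ℝ (Fin d)) : ℝ :=
  ∑ᶠ β, Jp p (ψ (x + ygrid d h β) - ψ x) * ω β

/-- `|ξ|^{p-2} ξ` truncated at height `c`: constant outside `[-c, c]`. -/
noncomputable def truncJp (p c ξ : ℝ) : ℝ := Jp p (max (-c) (min c ξ))

/-- The operator `ψ ↦ Σ_β g(ψ(x+y_β) - ψ(x)) ω_β` for a general flux `g`. -/
noncomputable def gridOp (d : ℕ) (h : ℝ) (ω : (Fin d → ℤ) → ℝ) (g : ℝ → ℝ)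
    (ψ : EuclideanSpace ℝ (Fin d) → ℝ) (x : EuclideanSpace ℝ (Fin d)) : ℝ :=
  ∑ᶠ β, g (ψ (x + ygrid d h β) - ψ x) * ω β

theorem Jp_neg (p ξ : ℝ) : Jp p (-ξ) = -Jp p ξ := by
  simp [Jp]

theorem Jp_of_nonneg {p ξ : ℝ} (hp : 2 ≤ p) (hξ : 0 ≤ ξ) : Jp p ξ = ξ ^ (p - 1) := by
  rw [Jp, abs_of_nonneg hξ, ← Real.rpow_add_one' hξ (by linarith)]
  congr 1
  ring

theorem Jp_nonneg {p ξ : ℝ} (hξ : 0 ≤ ξ) : 0 ≤ Jp p ξ :=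
  mul_nonneg (Real.rpow_nonneg (abs_nonneg _) _) hξ

theorem Jp_mono {p : ℝ} (hp : 2 ≤ p) : Monotone (Jp p) := by
  have key : ∀ x y : ℝ, 0 ≤ x → x ≤ y → Jp p x ≤ Jp p y := by
    intro x y hx hxy
    rw [Jp_of_nonneg hp hx, Jp_of_nonneg hp (hx.trans hxy)]
    exact Real.rpow_le_rpow hx hxy (by linarith)
  intro x y hxy
  rcases le_total 0 x with hx | hx
  · exact key x y hx hxy
  rcases le_total 0 y with hy | hy
  · have h1 := Jp_nonneg (p := p) (neg_nonneg.2 hx)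
    have h2 := Jp_nonneg (p := p) hy
    rw [Jp_neg] at h1
    linarith
  · have := key (-y) (-x) (neg_nonneg.2 hy) (neg_le_neg hxy)
    rw [Jp_neg, Jp_neg] at this
    linarith

theorem abs_Jp_sub_le_of_nonneg {p c A B : ℝ} (hp : 2 ≤ p) (hA0 : 0 ≤ A) (hAc : A ≤ c)
    (hB0 : 0 ≤ B) (hBc : B ≤ c) : |Jp p A - Jp p B| ≤ (p - 1) * c ^ (p - 2) * |A - B| := by
  rw [Jp_of_nonneg hp hA0, Jp_of_nonneg hp hB0]
  refine (convex_Icc (0 : ℝ) c).norm_image_sub_le_of_norm_hasDerivWithin_le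
    (f := fun x => x ^ (p - 1)) (f' := fun x => (p - 1) * x ^ (p - 1 - 1))
    (fun x _ => (Real.hasDerivAt_rpow_const (Or.inr (by linarith))).hasDerivWithinAt)
    (fun x hx => ?_) ⟨hB0, hBc⟩ ⟨hA0, hAc⟩
  rw [Real.norm_of_nonneg (mul_nonneg (by linarith) (Real.rpow_nonneg hx.1 _)),
    show p - 1 - 1 = p - 2 by ring]
  exact mul_le_mul_of_nonneg_left (Real.rpow_le_rpow hx.1 hx.2 (by linarith)) (by linarith)

theorem abs_Jp_sub_le {p c A B : ℝ} (hp : 2 ≤ p) (hA : |A| ≤ c) (hB : |B| ≤ c) :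
    |Jp p A - Jp p B| ≤ (p - 1) * c ^ (p - 2) * |A - B| := by
  wlog hBA : B ≤ A generalizing A B
  · rw [abs_sub_comm, abs_sub_comm A]
    exact this hB hA (le_of_not_ge hBA)
  rw [abs_le] at hA hB
  have hc : 0 ≤ c := by linarith
  rcases le_total 0 B with h0 | h0
  · exact abs_Jp_sub_le_of_nonneg hp (h0.trans hBA) hA.2 h0 hB.2
  rcases le_total A 0 with h1 | h1
  · have := abs_Jp_sub_le_of_nonneg (c := c) (A := -B) (B := -A) hp (by linarith) (by linarith)
      (by linarith) (by linarith)
    rwa [Jp_neg, Jp_neg, show -Jp p B - -Jp p A = Jp p A - Jp p B by ring,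
      show -B - -A = A - B by ring] at this
  · have hA' := abs_Jp_sub_le_of_nonneg (B := 0) hp h1 hA.2 le_rfl hc
    have hB' := abs_Jp_sub_le_of_nonneg (A := -B) (B := 0) hp (by linarith) (by linarith) le_rfl hc
    have h00 : Jp p 0 = 0 := by simp [Jp]
    rw [Jp_neg, h00, sub_zero, sub_zero, abs_neg, abs_neg] at hB'
    rw [h00, sub_zero, sub_zero] at hA'
    calc |Jp p A - Jp p B| ≤ |Jp p A| + |Jp p B| := abs_sub _ _
      _ ≤ (p - 1) * c ^ (p - 2) * (|A| + |B|) := by linarith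
      _ = (p - 1) * c ^ (p - 2) * |A - B| := by
        rw [abs_of_nonneg h1, abs_of_nonpos h0, abs_of_nonneg (sub_nonneg.2 hBA)]
        ring

theorem truncJp_of_abs_le {p c ξ : ℝ} (h : |ξ| ≤ c) : truncJp p c ξ = Jp p ξ := by
  rw [abs_le] at h
  rw [truncJp, min_eq_right h.2, max_eq_right h.1]

theorem truncJp_mono {p c : ℝ} (hp : 2 ≤ p) : Monotone (truncJp p c) := fun _ _ h =>
  Jp_mono hp (max_le_max le_rfl (min_le_min le_rfl h))

theorem truncJp_neg {p c : ℝ} (hc : 0 ≤ c) (ξ : ℝ) : truncJp p c (-ξ) = -truncJp p c ξ := by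
  rw [truncJp, truncJp, ← Jp_neg]
  congr 1
  grind

theorem abs_clamp_sub_clamp_le (c A B : ℝ) :
    |max (-c) (min c A) - max (-c) (min c B)| ≤ |A - B| := by
  grind

theorem abs_clamp_le {c ξ : ℝ} (hc : 0 ≤ c) : |max (-c) (min c ξ)| ≤ c := by
  grind

theorem abs_clamp_le_abs {c : ℝ} (hc : 0 ≤ c) (ξ : ℝ) : |max (-c) (min c ξ)| ≤ |ξ| := by
  grind

theorem abs_truncJp_sub_le {p c A B : ℝ} (hp : 2 ≤ p) (hc : 0 ≤ c) :
    |truncJp p c A - truncJp p c B| ≤ (p - 1) * c ^ (p - 2) * |A - B| :=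
  (abs_Jp_sub_le hp (abs_clamp_le hc) (abs_clamp_le hc)).trans
    (mul_le_mul_of_nonneg_left (abs_clamp_sub_clamp_le c A B)
      (mul_nonneg (by linarith) (Real.rpow_nonneg hc _)))

theorem abs_truncJp_sub_le_of_abs_le {p c e A B : ℝ} (hp : 2 ≤ p) (hc : 0 ≤ c)
    (hA : |A| ≤ e) (hB : |B| ≤ e) :
    |truncJp p c A - truncJp p c B| ≤ (p - 1) * e ^ (p - 2) * |A - B| :=
  (abs_Jp_sub_le hp ((abs_clamp_le_abs hc A).trans hA) ((abs_clamp_le_abs hc B).trans hB)).trans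
    (mul_le_mul_of_nonneg_left (abs_clamp_sub_clamp_le c A B)
      (mul_nonneg (by linarith) (Real.rpow_nonneg ((abs_nonneg _).trans hA) _)))

theorem ygrid_neg (d : ℕ) (h : ℝ) (β : Fin d → ℤ) : ygrid d h (-β) = -ygrid d h β := by
  ext i
  simp [ygrid]

theorem finite_setOf_norm_ygrid_lt (d : ℕ) {h : ℝ} (hh : 0 < h) (r : ℝ) :
    {β : Fin d → ℤ | ‖ygrid d h β‖ < r}.Finite := by
  refine (Set.finite_Icc (fun _ => -⌈r / h⌉) (fun _ => ⌈r / h⌉) :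
    (Set.Icc (fun _ : Fin d => -⌈r / h⌉) (fun _ => ⌈r / h⌉)).Finite).subset fun β hβ => ?_
  have key : ∀ i, |β i| ≤ ⌈r / h⌉ := by
    intro i
    have h1 : ‖ygrid d h β i‖ < r := (PiLp.norm_apply_le (ygrid d h β) i).trans_lt hβ
    have h2 : h * |(β i : ℝ)| < r := by
      simpa [ygrid, abs_of_pos hh] using h1
    have h3 : |(β i : ℝ)| ≤ r / h := by
      rw [le_div_iff₀ hh]
      linarith
    exact_mod_cast h3.trans (Int.le_ceil _)
  exact ⟨fun i => (abs_le.1 (key i)).1, fun i => (abs_le.1 (key i)).2⟩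

theorem finite_support_of_range {d : ℕ} {h r : ℝ} (hh : 0 < h) {ω : (Fin d → ℤ) → ℝ}
    (hzero : ∀ β, r ≤ ‖ygrid d h β‖ → ω β = 0) : ω.support.Finite :=
  (finite_setOf_norm_ygrid_lt d hh r).subset fun β hβ => by
    by_contra hlt
    exact hβ (hzero β (not_lt.1 hlt))

theorem finsum_mul_eq_sum {ι : Type*} {ω : ι → ℝ} (hfin : ω.support.Finite) (g : ι → ℝ) :
    ∑ᶠ β, g β * ω β = ∑ β ∈ hfin.toFinset, g β * ω β :=
  finsum_eq_sum_of_support_subset _ fun β hβ => by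
    simp only [Set.Finite.coe_toFinset]
    exact right_ne_zero_of_mul hβ

theorem gridOp_congr {d : ℕ} {h : ℝ} {ω : (Fin d → ℤ) → ℝ} {g₁ g₂ : ℝ → ℝ}
    {ψ : EuclideanSpace ℝ (Fin d) → ℝ} {x : EuclideanSpace ℝ (Fin d)}
    (hg : ∀ β, ω β ≠ 0 → g₁ (ψ (x + ygrid d h β) - ψ x) = g₂ (ψ (x + ygrid d h β) - ψ x)) :
    gridOp d h ω g₁ ψ x = gridOp d h ω g₂ ψ x := by
  refine finsum_congr fun β => ?_
  by_cases hβ : ω β = 0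
  · simp [hβ]
  · rw [hg β hβ]

/-- One-sided comparison for an explicit step with a monotone Lipschitz flux. -/
theorem explicit_step_sub_le {d : ℕ} {h τ κ m : ℝ} {ω : (Fin d → ℤ) → ℝ}
    (hfin : ω.support.Finite) (hnn : ∀ β, 0 ≤ ω β) {g : ℝ → ℝ} (hmono : Monotone g)
    (hlip : ∀ A B, |g A - g B| ≤ κ * |A - B|) (hκ : 0 ≤ κ) (hτ : 0 ≤ τ)
    (hstab : τ * (κ * ∑ᶠ β, ω β) ≤ 1) {ψ φ : EuclideanSpace ℝ (Fin d) → ℝ}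
    (x z : EuclideanSpace ℝ (Fin d)) (hm : ∀ x, ψ (x + z) - φ x ≤ m) :
    ψ (x + z) + τ * gridOp d h ω g ψ (x + z) - (φ x + τ * gridOp d h ω g φ x) ≤ m := by
  have hflux : ∀ β, g (ψ (x + z + ygrid d h β) - ψ (x + z)) - g (φ (x + ygrid d h β) - φ x) ≤
      κ * (m - (ψ (x + z) - φ x)) := by
    intro β
    have h1 := hm (x + ygrid d h β)
    rw [add_right_comm] at h1
    set A := ψ (x + z + ygrid d h β) - ψ (x + z)
    set B := φ (x + ygrid d h β) - φ x
    rcases le_total A B with hAB | hAB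
    · exact (sub_nonpos.2 (hmono hAB)).trans (mul_nonneg hκ (sub_nonneg.2 (hm x)))
    · refine (le_abs_self _).trans ((hlip A B).trans (mul_le_mul_of_nonneg_left ?_ hκ))
      rw [abs_of_nonneg (sub_nonneg.2 hAB)]
      linarith
  have hdiff : gridOp d h ω g ψ (x + z) - gridOp d h ω g φ x ≤
      (m - (ψ (x + z) - φ x)) * (κ * ∑ᶠ β, ω β) := by
    have hω : ∑ᶠ β, ω β = ∑ β ∈ hfin.toFinset, ω β := by
      simpa using finsum_mul_eq_sum hfin (fun _ => 1)
    rw [gridOp, gridOp, finsum_mul_eq_sum hfin, finsum_mul_eq_sum hfin, hω,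
      ← Finset.sum_sub_distrib, Finset.mul_sum, Finset.mul_sum]
    refine Finset.sum_le_sum fun β _ => ?_
    nlinarith [mul_le_mul_of_nonneg_right (hflux β) (hnn β)]
  have h1 := mul_le_mul_of_nonneg_left hdiff hτ
  have h2 := mul_le_mul_of_nonneg_left hstab (sub_nonneg.2 (hm x))
  linarith

/-- Contraction in the supremum norm, up to a translation by `z`, of an explicit step. -/
theorem abs_explicit_step_sub_le {d : ℕ} {h τ κ m : ℝ} {ω : (Fin d → ℤ) → ℝ}
    (hfin : ω.support.Finite) (hnn : ∀ β, 0 ≤ ω β) {g : ℝ → ℝ} (hmono : Monotone g)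
    (hlip : ∀ A B, |g A - g B| ≤ κ * |A - B|) (hκ : 0 ≤ κ) (hτ : 0 ≤ τ)
    (hstab : τ * (κ * ∑ᶠ β, ω β) ≤ 1) {ψ φ : EuclideanSpace ℝ (Fin d) → ℝ}
    (x z : EuclideanSpace ℝ (Fin d)) (hm : ∀ x, |ψ (x + z) - φ x| ≤ m) :
    |ψ (x + z) + τ * gridOp d h ω g ψ (x + z) - (φ x + τ * gridOp d h ω g φ x)| ≤ m := by
  have h1 := explicit_step_sub_le (h := h) hfin hnn hmono hlip hκ hτ hstab x z
    fun x => (abs_le.1 (hm x)).2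
  have h2 := explicit_step_sub_le (h := h) (ψ := φ) (φ := ψ) (m := m) hfin hnn hmono hlip hκ hτ
    hstab (x + z) (-z) fun x => by
      have := (abs_le.1 (hm (x + -z))).1
      rw [neg_add_cancel_right] at this
      linarith
  rw [add_neg_cancel_right] at h2
  exact abs_le.2 ⟨by linarith, h1⟩

/-- Bound for a grid operator with odd flux and symmetric weights in terms of the symmetrised
fluxes. -/
theorem abs_gridOp_le_of_symm {d : ℕ} {h b W : ℝ} {ω : (Fin d → ℤ) → ℝ}
    (hfin : ω.support.Finite) (hsym : ∀ β, ω (-β) = ω β) (hnn : ∀ β, 0 ≤ ω β) (g : ℝ → ℝ)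
    {ψ : EuclideanSpace ℝ (Fin d) → ℝ} {x : EuclideanSpace ℝ (Fin d)}
    (hb0 : 0 ≤ b) (hW : ∑ᶠ β, ω β ≤ W)
    (hb : ∀ β, ω β ≠ 0 →
      |g (ψ (x + ygrid d h β) - ψ x) + g (ψ (x - ygrid d h β) - ψ x)| ≤ b) :
    |gridOp d h ω g ψ x| ≤ b * W / 2 := by
  have hω : ∑ᶠ β, ω β = ∑ β ∈ hfin.toFinset, ω β := by
    simpa using finsum_mul_eq_sum hfin (fun _ => 1)
  have hrefl : gridOp d h ω g ψ x = ∑ᶠ β, g (ψ (x - ygrid d h β) - ψ x) * ω β := by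
    rw [gridOp, ← finsum_comp_equiv (Equiv.neg (Fin d → ℤ))]
    exact finsum_congr fun β => by
      simp only [Equiv.neg_apply, ygrid_neg, hsym, sub_eq_add_neg]
  have hdouble : 2 * gridOp d h ω g ψ x = ∑ β ∈ hfin.toFinset,
      (g (ψ (x + ygrid d h β) - ψ x) + g (ψ (x - ygrid d h β) - ψ x)) * ω β := by
    rw [two_mul]
    nth_rewrite 2 [hrefl]
    rw [gridOp, finsum_mul_eq_sum hfin, finsum_mul_eq_sum hfin, ← Finset.sum_add_distrib]
    exact Finset.sum_congr rfl fun β _ => by ring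
  have hle : |2 * gridOp d h ω g ψ x| ≤ b * W := by
    rw [hdouble]
    refine (Finset.abs_sum_le_sum_abs _ _).trans (le_trans ?_ (mul_le_mul_of_nonneg_left hW hb0))
    rw [hω, Finset.mul_sum]
    refine Finset.sum_le_sum fun β hβ => ?_
    rw [abs_mul, abs_of_nonneg (hnn β)]
    exact mul_le_mul_of_nonneg_right (hb β (by simpa using hβ)) (hnn β)
  rw [abs_mul, abs_two] at hle
  linarith

/-- The truncated discrete `p`-Laplacian of a function with controlled first and second
differences. -/
theorem abs_gridOp_truncJp_le {d : ℕ} {p h r M c k₁ k₂ : ℝ} (hp : 2 ≤ p) (hh : 0 < h)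
    (hr : 0 < r) {ω : (Fin d → ℤ) → ℝ} (hsym : ∀ β, ω (-β) = ω β) (hnn : ∀ β, 0 ≤ ω β)
    (hzero : ∀ β, r ≤ ‖ygrid d h β‖ → ω β = 0) (hsum : ∑ᶠ β, ω β ≤ M * r ^ (-p))
    (hc : 0 ≤ c) (hk₁ : 0 ≤ k₁) (hk₂ : 0 ≤ k₂) {v : EuclideanSpace ℝ (Fin d) → ℝ}
    (hv₁ : ∀ x y, |v (x + y) - v x| ≤ k₁ * ‖y‖)
    (hv₂ : ∀ x y, |v (x + y) + v (x - y) - 2 * v x| ≤ k₂ * ‖y‖ ^ (2 : ℕ))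
    (x : EuclideanSpace ℝ (Fin d)) :
    |gridOp d h ω (truncJp p c) v x| ≤ (p - 1) * k₁ ^ (p - 2) * k₂ * M / 2 := by
  have hb : ∀ β, ω β ≠ 0 → |truncJp p c (v (x + ygrid d h β) - v x) +
      truncJp p c (v (x - ygrid d h β) - v x)| ≤
      (p - 1) * (k₁ * r) ^ (p - 2) * (k₂ * r ^ (2 : ℕ)) := by
    intro β hβ
    have hy : ‖ygrid d h β‖ ≤ r := (lt_of_not_ge fun hge => hβ (hzero β hge)).le
    set y := ygrid d h β
    have hA : |v (x + y) - v x| ≤ k₁ * r := (hv₁ x y).trans (mul_le_mul_of_nonneg_left hy hk₁)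
    have hB : |-(v (x - y) - v x)| ≤ k₁ * r := by
      rw [abs_neg, sub_eq_add_neg]
      refine (hv₁ x (-y)).trans (mul_le_mul_of_nonneg_left ?_ hk₁)
      rwa [norm_neg]
    have hAB := abs_truncJp_sub_le_of_abs_le hp hc hA hB
    rw [truncJp_neg hc, sub_neg_eq_add, sub_neg_eq_add,
      show v (x + y) - v x + (v (x - y) - v x) = v (x + y) + v (x - y) - 2 * v x by ring] at hAB
    refine hAB.trans (mul_le_mul_of_nonneg_left ((hv₂ x y).trans ?_)
      (mul_nonneg (by linarith) (Real.rpow_nonneg (mul_nonneg hk₁ hr.le) _)))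
    exact mul_le_mul_of_nonneg_left (pow_le_pow_left₀ (norm_nonneg _) hy 2) hk₂
  refine (abs_gridOp_le_of_symm (finite_support_of_range hh hzero) hsym hnn _
    (mul_nonneg (mul_nonneg (by linarith) (Real.rpow_nonneg (mul_nonneg hk₁ hr.le) _))
      (mul_nonneg hk₂ (sq_nonneg r))) hsum hb).trans_eq ?_
  have hrp : r ^ (p - 2) * r ^ (2 : ℕ) * r ^ (-p) = 1 := by
    rw [← Real.rpow_natCast r 2, ← Real.rpow_add hr, ← Real.rpow_add hr]
    norm_num
  rw [Real.mul_rpow hk₁ hr.le]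
  linear_combination (p - 1) * k₁ ^ (p - 2) * k₂ * M / 2 * hrp

/-- The minimising choice of the mollification scale. -/
theorem optimal_scale_bound {p a q Lu C t : ℝ} (hp : 2 ≤ p) (ha : a ≤ 1)
    (hq : q = 2 + (1 - a) * (p - 2)) (hLu : 0 < Lu) (hC : 0 < C) (ht : 0 < t) :
    ∃ δ : ℝ, 0 < δ ∧
      2 * (Lu * δ ^ a) + C * Lu ^ (p - 1) * δ ^ (a - q) / 2 * t =
        4 ^ ((q - a) / q) * Lu ^ (p / q) * C ^ (a / q) * t ^ (a / q) := by
  have hq0 : 0 < q := by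
    rw [hq]
    nlinarith [mul_nonneg (sub_nonneg.2 ha) (sub_nonneg.2 hp)]
  have hLp : 0 < Lu ^ (p - 2) := Real.rpow_pos_of_pos hLu _
  set X := 1 / 4 * C * Lu ^ (p - 2) * t with hX
  have hX0 : 0 < X := by positivity
  refine ⟨X ^ (1 / q), Real.rpow_pos_of_pos hX0 _, ?_⟩
  have e1 : (X ^ (1 / q)) ^ a = X ^ (a / q) := by
    rw [← Real.rpow_mul hX0.le]
    congr 1
    ring
  have e2 : (X ^ (1 / q)) ^ (a - q) = X ^ (a / q) / X := by
    rw [← Real.rpow_mul hX0.le, ← Real.rpow_sub_one hX0.ne']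
    congr 1
    field_simp
  have e3 : X ^ (a / q) =
      4 ^ (-(a / q)) * C ^ (a / q) * Lu ^ ((p - 2) * (a / q)) * t ^ (a / q) := by
    rw [hX, Real.mul_rpow (by positivity) ht.le, Real.mul_rpow (by positivity) hLp.le,
      Real.mul_rpow (by norm_num) hC.le, ← Real.rpow_mul hLu.le, one_div,
      Real.inv_rpow (by norm_num), Real.rpow_neg (by norm_num)]
  have e4 : (4 : ℝ) ^ ((q - a) / q) = 4 * 4 ^ (-(a / q)) := by
    rw [show (q - a) / q = 1 + -(a / q) by field_simp; ring, Real.rpow_add (by norm_num),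
      Real.rpow_one]
  have e5 : Lu ^ (p / q) = Lu * Lu ^ ((p - 2) * (a / q)) := by
    rw [show p / q = 1 + (p - 2) * (a / q) by field_simp; rw [hq]; ring, Real.rpow_add hLu,
      Real.rpow_one]
  have e6 : Lu ^ (p - 1) = Lu ^ (p - 2) * Lu := by
    rw [← Real.rpow_add_one hLu.ne']
    congr 1
    ring
  have e7 : C * Lu ^ (p - 1) * (X ^ (a / q) / X) / 2 * t = 2 * (Lu * X ^ (a / q)) := by
    rw [e6]
    field_simp
    rw [hX]
    ring
  rw [e1, e2, e7, e4, e5, e3]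
  ring

/-- Equicontinuity in time for the extended scheme (Proposition 3.6). -/
theorem scheme_time_equicontinuity (d : ℕ) (hd : 1 ≤ d) (p : ℝ) (hp : 2 ≤ p)
    (h r τ : ℝ) (hh : 0 < h) (hr : 0 < r) (hτ : 0 < τ) (N : ℕ) (M : ℝ) (hM : 0 < M)
    (ω : (Fin d → ℤ) → ℝ) (hsym : ∀ β, ω (-β) = ω β) (hnn : ∀ β, 0 ≤ ω β)
    (hzero : ∀ β, r ≤ ‖ygrid d h β‖ → ω β = 0)
    (hsum : ∑ᶠ β, ω β ≤ M * r ^ (-p))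
    (a Lu Lf : ℝ) (ha0 : 0 < a) (ha1 : a ≤ 1) (hLu : 0 < Lu)
    (u₀ f : EuclideanSpace ℝ (Fin d) → ℝ)
    (hu₀b : BddAbove (Set.range fun x => |u₀ x|))
    (hfb : BddAbove (Set.range fun x => |f x|))
    (hu₀ : ∀ x y, |u₀ x - u₀ y| ≤ Lu * ‖x - y‖ ^ a)
    (hf : ∀ x y, |f x - f y| ≤ Lf * ‖x - y‖ ^ a)
    (K₁ K₂ : ℝ) (hK₁ : 0 < K₁) (hK₂ : 0 < K₂)
    (hmoll : ∀ δ : ℝ, 0 < δ → ∃ v : EuclideanSpace ℝ (Fin d) → ℝ,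
      (∃ C, ∀ x, |v x| ≤ C) ∧
      (∀ x, |u₀ x - v x| ≤ Lu * δ ^ a) ∧
      (∀ x y, |v (x + y) - v x| ≤ K₁ * Lu * δ ^ (a - 1) * ‖y‖) ∧
      (∀ x y, |v (x + y) + v (x - y) - 2 * v x| ≤ K₂ * Lu * δ ^ (a - 2) * ‖y‖ ^ (2 : ℕ)))
    (U : ℕ → EuclideanSpace ℝ (Fin d) → ℝ)
    (hU0 : ∀ x, U 0 x = u₀ x)
    (hUrec : ∀ j x, U (j + 1) x = U j x + τ * (Dph d p h ω (U j) x + f x))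
    (hCFL : τ * (p - 1) * M * (Lu + (N : ℝ) * τ * Lf) ^ (p - 2) ≤
      r ^ (2 + (1 - a) * (p - 2))) :
    ∀ j k, j + k ≤ N → ∀ x,
      |U (j + k) x - U j x| ≤
        4 ^ ((2 + (1 - a) * (p - 2) - a) / (2 + (1 - a) * (p - 2))) *
            Lu ^ (p / (2 + (1 - a) * (p - 2))) *
            ((p - 1) * K₁ ^ (p - 2) * K₂ * M) ^ (a / (2 + (1 - a) * (p - 2))) *
            ((k : ℝ) * τ) ^ (a / (2 + (1 - a) * (p - 2))) +
          (⨆ x, |f x|) * ((k : ℝ) * τ) := by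
  have hLf : 0 ≤ Lf := by
    have : Nonempty (Fin d) := ⟨⟨0, hd⟩⟩
    obtain ⟨w, hw⟩ := exists_ne (0 : EuclideanSpace ℝ (Fin d))
    have hpos : 0 < ‖w - 0‖ ^ a := Real.rpow_pos_of_pos (by simpa using hw) _
    exact nonneg_of_mul_nonneg_left ((abs_nonneg _).trans (hf w 0)) hpos
  have hfin := finite_support_of_range hh hzero
  set L := Lu + (N : ℝ) * τ * Lf with hL
  have hL0 : 0 < L := by positivity
  set c := L * r ^ a with hc
  have hc0 : 0 ≤ c := by positivity
  set κ := (p - 1) * c ^ (p - 2) with hκ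
  have hκ0 : 0 ≤ κ := mul_nonneg (by linarith) (Real.rpow_nonneg hc0 _)
  have hstab : τ * (κ * ∑ᶠ β, ω β) ≤ 1 := by
    calc τ * (κ * ∑ᶠ β, ω β) ≤ τ * (κ * (M * r ^ (-p))) := by gcongr
      _ = τ * (p - 1) * M * L ^ (p - 2) * ((r ^ a) ^ (p - 2) * r ^ (-p)) := by
        rw [hκ, hc, Real.mul_rpow hL0.le (by positivity)]
        ring
      _ ≤ r ^ (2 + (1 - a) * (p - 2)) * ((r ^ a) ^ (p - 2) * r ^ (-p)) := by gcongr
      _ = 1 := by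
        rw [← Real.rpow_mul hr.le, ← Real.rpow_add hr, ← Real.rpow_add hr,
          show 2 + (1 - a) * (p - 2) + (a * (p - 2) + -p) = 0 by ring, Real.rpow_zero]
  set g := truncJp p c with hg
  have hmono : Monotone g := truncJp_mono hp
  have hlip : ∀ A B, |g A - g B| ≤ κ * |A - B| := fun A B => abs_truncJp_sub_le hp hc0
  -- a function with Hölder constant `L` does not see the truncation
  have htrunc : ∀ ψ : EuclideanSpace ℝ (Fin d) → ℝ,
      (∀ x z, |ψ (x + z) - ψ x| ≤ L * ‖z‖ ^ a) → ∀ x, Dph d p h ω ψ x = gridOp d h ω g ψ x := by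
    intro ψ hψ x
    refine gridOp_congr (g₁ := Jp p) fun β hβ => (truncJp_of_abs_le ((hψ _ _).trans ?_)).symm
    have hy : ‖ygrid d h β‖ ≤ r := (lt_of_not_ge fun hge => hβ (hzero β hge)).le
    rw [hc]
    gcongr
  have hhol : ∀ j ≤ N, ∀ x z, |U j (x + z) - U j x| ≤ (Lu + (j : ℝ) * τ * Lf) * ‖z‖ ^ a ∧
      |U j (x + z) - U j x| ≤ L * ‖z‖ ^ a := by
    have hle : ∀ j ≤ N, ∀ z : EuclideanSpace ℝ (Fin d),
        (Lu + (j : ℝ) * τ * Lf) * ‖z‖ ^ a ≤ L * ‖z‖ ^ a := by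
      intro j hj z
      have : (j : ℝ) ≤ N := by exact_mod_cast hj
      rw [hL]
      gcongr
    intro j
    induction j with
    | zero =>
      intro hj x z
      have h0 : |U 0 (x + z) - U 0 x| ≤ (Lu + ((0 : ℕ) : ℝ) * τ * Lf) * ‖z‖ ^ a := by
        simpa [hU0] using hu₀ (x + z) x
      exact ⟨h0, h0.trans (hle 0 hj z)⟩
    | succ j ih =>
      intro hj x z
      have ih' := ih (by omega)
      have hD := htrunc (U j) fun x z => (ih' x z).2
      have hstep := abs_explicit_step_sub_le (h := h) hfin hnn hmono hlip hκ0 hτ.le hstab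
        x z fun x => (ih' x z).1
      have hfz : |f (x + z) - f x| ≤ Lf * ‖z‖ ^ a := by simpa using hf (x + z) x
      have h1 : |U (j + 1) (x + z) - U (j + 1) x| ≤
          (Lu + ((j + 1 : ℕ) : ℝ) * τ * Lf) * ‖z‖ ^ a := by
        rw [hUrec, hUrec, hD, hD]
        calc _ = |(U j (x + z) + τ * gridOp d h ω g (U j) (x + z) -
                (U j x + τ * gridOp d h ω g (U j) x)) + τ * (f (x + z) - f x)| := by
              congr 1
              ring
          _ ≤ (Lu + (j : ℝ) * τ * Lf) * ‖z‖ ^ a + τ * (Lf * ‖z‖ ^ a) := by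
            refine (abs_add_le _ _).trans (add_le_add hstep ?_)
            rw [abs_mul, abs_of_pos hτ]
            gcongr
          _ = _ := by
            push_cast
            ring
      exact ⟨h1, h1.trans (hle _ hj z)⟩
  have hrec : ∀ j ≤ N, ∀ x,
      U (j + 1) x = U j x + τ * gridOp d h ω g (U j) x + τ * f x := by
    intro j hj x
    rw [hUrec, htrunc (U j) fun x z => (hhol j hj x z).2]
    ring
  have hcontr : ∀ (ψ φ : EuclideanSpace ℝ (Fin d) → ℝ) (m : ℝ), (∀ x, |ψ x - φ x| ≤ m) → ∀ x,
      |ψ x + τ * gridOp d h ω g ψ x - (φ x + τ * gridOp d h ω g φ x)| ≤ m := by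
    intro ψ φ m hm x
    simpa using abs_explicit_step_sub_le (h := h) hfin hnn hmono hlip hκ0 hτ.le hstab x 0
      (ψ := ψ) (φ := φ) (m := m) (by simpa using hm)
  have hshift : ∀ k m, (∀ x, |U k x - U 0 x| ≤ m) → ∀ j, j + k ≤ N → ∀ x,
      |U (j + k) x - U j x| ≤ m := by
    intro k m hm j
    induction j with
    | zero => simpa using fun _ : k ≤ N => hm
    | succ j ih =>
      intro hj x
      rw [show j + 1 + k = j + k + 1 by omega, hrec _ (by omega), hrec _ (by omega),
        add_sub_add_right_eq_sub]
      exact hcontr _ _ _ (ih (by omega)) x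
  set F := ⨆ x, |f x| with hF
  have hfF : ∀ x, |f x| ≤ F := fun x => le_ciSup hfb x
  intro j k hjk
  refine hshift k _ (fun x => ?_) j hjk
  rcases Nat.eq_zero_or_pos k with rfl | hkpos
  · simp only [sub_self, abs_zero]
    have hF0 : 0 ≤ F := (abs_nonneg _).trans (hfF x)
    have hp1 : 0 ≤ p - 1 := by linarith
    positivity
  set q := 2 + (1 - a) * (p - 2) with hq
  have hC : 0 < (p - 1) * K₁ ^ (p - 2) * K₂ * M := by
    have hp1 : 0 < p - 1 := by linarith
    positivity
  have ht : 0 < (k : ℝ) * τ := by positivity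
  obtain ⟨δ, hδ, hopt⟩ := optimal_scale_bound hp ha1 hq hLu hC ht
  obtain ⟨v, -, hv0, hv1, hv2⟩ := hmoll δ hδ
  have hDv : ∀ x, |gridOp d h ω g v x| ≤
      (p - 1) * K₁ ^ (p - 2) * K₂ * M * Lu ^ (p - 1) * δ ^ (a - q) / 2 := by
    intro x
    refine (abs_gridOp_truncJp_le hp hh hr hsym hnn hzero hsum hc0 (by positivity)
      (by positivity) hv1 hv2 x).trans_eq ?_
    have e1 : Lu ^ (p - 1) = Lu ^ (p - 2) * Lu := by
      rw [← Real.rpow_add_one hLu.ne']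
      congr 1
      ring
    have e2 : δ ^ (a - q) = (δ ^ (a - 1)) ^ (p - 2) * δ ^ (a - 2) := by
      rw [← Real.rpow_mul hδ.le, ← Real.rpow_add hδ]
      congr 1
      rw [hq]
      ring
    rw [Real.mul_rpow (by positivity) (by positivity), Real.mul_rpow hK₁.le hLu.le, e1, e2]
    ring
  set D := (p - 1) * K₁ ^ (p - 2) * K₂ * M * Lu ^ (p - 1) * δ ^ (a - q) / 2 with hDdef
  have hdrift : ∀ i ≤ N, ∀ x, |U i x - v x| ≤ Lu * δ ^ a + (i : ℝ) * τ * (D + F) := by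
    intro i
    induction i with
    | zero => intro _ x; simpa [hU0] using hv0 x
    | succ i ih =>
      intro hi x
      have hstep := hcontr _ _ _ (ih (by omega)) x
      have hsrc : |gridOp d h ω g v x + f x| ≤ D + F :=
        (abs_add_le _ _).trans (add_le_add (hDv x) (hfF x))
      rw [hrec i (by omega)]
      calc _ = |(U i x + τ * gridOp d h ω g (U i) x - (v x + τ * gridOp d h ω g v x)) +
              τ * (gridOp d h ω g v x + f x)| := by
            congr 1
            ring
        _ ≤ Lu * δ ^ a + (i : ℝ) * τ * (D + F) + τ * (D + F) := by
          refine (abs_add_le _ _).trans (add_le_add hstep ?_)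
          rw [abs_mul, abs_of_pos hτ]
          gcongr
        _ = _ := by
          push_cast
          ring
  rw [← hopt]
  have h1 := hdrift k (by omega) x
  have h2 := hv0 x
  rw [hU0]
  calc |U k x - u₀ x| ≤ |U k x - v x| + |v x - u₀ x| := abs_sub_le _ _ _
    _ ≤ _ := by
      rw [abs_sub_comm (v x)]
      linarith
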